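/- Let M be a loop-free matroid of rank r with finite ground set E. Then for every x ∈ ℝ^E, 1_{Δ(M)}(x) = Σ_{F•} (−1)^{k−1} · 1_{⊓^{F•,M}}(x), where the sum is over all chains F• : ∅ = F₀ ⊊ F₁ ⊊ ⋯ ⊊ F_k = E (of any length k) in which every F_i is a flat of M. -/

import Mathlib

/-- The base polytope of a matroid of rank `r` with rank function `rank`:
`{x : Σ_{e ∈ S} x_e ≤ rank S for all S, and Σ_e x_e = r}`. -/
def basePolytope {α : Type*} [Fintype α] (rank : Finset α → ℕ) (r : ℕ) : Set (α → ℝ) :=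
  {x | (∀ S : Finset α, ∑ e ∈ S, x e ≤ (rank S : ℝ)) ∧ ∑ e, x e = (r : ℝ)}

/-- The hypersimplex `Δ(r, E)`. -/
def hypersimplex (α : Type*) [Fintype α] (r : ℕ) : Set (α → ℝ) :=
  {x | (∀ e, 0 ≤ x e ∧ x e ≤ 1) ∧ ∑ e, x e = (r : ℝ)}

/-- The half-open Schubert polytope `⊓^{F•,M}` associated to a chain whose set of
intermediate members is `C`: the points of the hypersimplex satisfying
`Σ_{e ∈ A} x_e > rank A` for each member `A` of the chain. -/
def halfOpenSchubert {α : Type*} [Fintype α] (rank : Finset α → ℕ) (r : ℕ)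
    (C : Finset (Finset α)) : Set (α → ℝ) :=
  {x | x ∈ hypersimplex α r ∧ ∀ A ∈ C, (rank A : ℝ) < ∑ e ∈ A, x e}

/-- `F` is a flat: adding any element outside `F` increases the rank. -/
def IsFlat {α : Type*} [Fintype α] [DecidableEq α] (rank : Finset α → ℕ)
    (F : Finset α) : Prop :=
  ∀ e : α, e ∉ F → rank F < rank (insert e F)


instance {α : Type*} [Fintype α] [DecidableEq α] (rank : Finset α → ℕ) (F : Finset α) :
    Decidable (IsFlat rank F) :=
  inferInstanceAs (Decidable (∀ e : α, e ∉ F → rank F < rank (insert e F)))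

/-- The signed count of chains in `P` vanishes if `P` contains a set `A` and is closed under
intersecting with `A`. -/
theorem sum_neg_one_pow_card_chains_eq_zero {α : Type*} [Fintype α] [DecidableEq α]
    {P : Finset (Finset α)} {A : Finset α} (hA : A ∈ P) (hP : ∀ B ∈ P, B ∩ A ∈ P) :
    ∑ C ∈ P.powerset.filter (fun C => ∀ A ∈ C, ∀ B ∈ C, A ⊆ B ∨ B ⊆ A),
      (-1 : ℤ) ^ C.card = 0 := by
  let t : Finset (Finset α) → Finset α := fun C => (C.filter (fun B => ¬ B ⊆ A)).inf id ∩ A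
  have ht_le : ∀ C, t C ⊆ A := fun C => Finset.inter_subset_right
  have ht_sub : ∀ C, ∀ D ∈ C, ¬ D ⊆ A → t C ⊆ D := fun C D hD hDA =>
    Finset.inter_subset_left.trans
      (Finset.inf_le (f := id) (Finset.mem_filter.2 ⟨hD, hDA⟩))
  have ht_sup : ∀ C : Finset (Finset α), (∀ A ∈ C, ∀ B ∈ C, A ⊆ B ∨ B ⊆ A) →
      ∀ D ∈ C, D ⊆ A → D ⊆ t C := by
    intro C hC D hD hDA
    refine Finset.subset_inter (Finset.le_inf (f := id) fun B hB => ?_) hDA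
    obtain ⟨hB, hBA⟩ := Finset.mem_filter.1 hB
    exact (hC D hD B hB).resolve_right fun h => hBA (h.trans hDA)
  have ht_mem : ∀ C : Finset (Finset α), C ⊆ P → (∀ A ∈ C, ∀ B ∈ C, A ⊆ B ∨ B ⊆ A) →
      t C ∈ P := by
    intro C hCP hC
    rcases (C.filter (fun B => ¬ B ⊆ A)).eq_empty_or_nonempty with h | h
    · simpa [t, h] using hA
    · obtain ⟨B, hB, hmin⟩ := Finset.exists_min_image _ Finset.card h
      have hinf : (C.filter (fun B => ¬ B ⊆ A)).inf id = B := by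
        refine le_antisymm (Finset.inf_le (f := id) hB) (Finset.le_inf (f := id) fun D hD => ?_)
        rcases hC B (Finset.mem_filter.1 hB).1 D (Finset.mem_filter.1 hD).1 with h | h
        · exact h
        · exact (Finset.eq_of_subset_of_card_le h (hmin D hD)).ge
      simpa only [t, hinf] using hP B (hCP (Finset.mem_filter.1 hB).1)
  have ht_insert : ∀ C, t (insert (t C) C) = t C := by
    intro C
    change (Finset.filter _ (insert (t C) C)).inf id ∩ A = _
    rw [Finset.filter_insert, if_neg (not_not.2 (ht_le C))]
  have ht_erase : ∀ C, t (C.erase (t C)) = t C := by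
    intro C
    change (Finset.filter _ (C.erase (t C))).inf id ∩ A = _
    rw [Finset.filter_erase, Finset.erase_eq_of_notMem]
    simp [ht_le C]
  refine Finset.sum_involution
    (fun C _ => if t C ∈ C then C.erase (t C) else insert (t C) C) ?_ ?_ ?_ ?_
  · intro C _
    by_cases h : t C ∈ C
    · simp only [h, if_true]
      rw [← Finset.card_erase_add_one h, pow_succ]
      ring
    · simp only [h, if_false]
      rw [Finset.card_insert_of_notMem h, pow_succ]
      ring
  · intro C _ _
    by_cases h : t C ∈ C
    · simp [h]
    · simp only [h, if_false, ne_eq, Finset.insert_eq_self, not_false_eq_true]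
  · intro C hC
    obtain ⟨hCP, hchain⟩ := Finset.mem_filter.1 hC
    rw [Finset.mem_powerset] at hCP
    rw [Finset.mem_filter, Finset.mem_powerset]
    by_cases h : t C ∈ C
    · simp only [h, if_true]
      exact ⟨(Finset.erase_subset _ _).trans hCP, fun D hD B hB =>
        hchain D (Finset.mem_of_mem_erase hD) B (Finset.mem_of_mem_erase hB)⟩
    · simp only [h, if_false]
      have hcomp : ∀ D ∈ C, D ⊆ t C ∨ t C ⊆ D := fun D hD => by
        by_cases hDA : D ⊆ A
        · exact Or.inl (ht_sup C hchain D hD hDA)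
        · exact Or.inr (ht_sub C D hD hDA)
      refine ⟨Finset.insert_subset (ht_mem C hCP hchain) hCP, fun D hD B hB => ?_⟩
      rcases Finset.mem_insert.1 hD with rfl | hD <;> rcases Finset.mem_insert.1 hB with rfl | hB
      · exact Or.inl subset_rfl
      · exact (hcomp B hB).symm
      · exact hcomp D hD
      · exact hchain D hD B hB
  · intro C _
    by_cases h : t C ∈ C
    · simp only [h, if_true, ht_erase, Finset.notMem_erase, if_false]
      exact Finset.insert_erase h
    · simp only [h, if_false, ht_insert, Finset.mem_insert_self, if_true]
      exact Finset.erase_insert h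

theorem exists_isFlat_superset {α : Type*} [Fintype α] [DecidableEq α] {rank : Finset α → ℕ}
    (hrank_mono : ∀ ⦃S T : Finset α⦄, S ⊆ T → rank S ≤ rank T) (S : Finset α) :
    ∃ T, S ⊆ T ∧ rank T = rank S ∧ IsFlat rank T := by
  obtain ⟨T, hT, hmax⟩ := Finset.exists_max_image
    (Finset.univ.filter fun T => S ⊆ T ∧ rank T = rank S) Finset.card ⟨S, by simp⟩
  simp only [Finset.mem_filter, Finset.mem_univ, true_and] at hT hmax
  refine ⟨T, hT.1, hT.2, fun e he => ?_⟩
  refine lt_of_le_of_ne (hrank_mono (Finset.subset_insert e T)) fun h => ?_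
  have := hmax (insert e T) ⟨hT.1.trans (Finset.subset_insert e T), by rw [← h, hT.2]⟩
  rw [Finset.card_insert_of_notMem he] at this
  omega

theorem IsFlat.inter {α : Type*} [Fintype α] [DecidableEq α] {rank : Finset α → ℕ}
    (hrank_submod : ∀ S T : Finset α, rank (S ∪ T) + rank (S ∩ T) ≤ rank S + rank T)
    {F G : Finset α} (hF : IsFlat rank F) (hG : IsFlat rank G) : IsFlat rank (F ∩ G) := by
  have key : ∀ {F G : Finset α} {e : α}, IsFlat rank F → e ∉ F →
      rank (F ∩ G) < rank (insert e (F ∩ G)) := by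
    intro F G e hF he
    have h := hrank_submod F (insert e (F ∩ G))
    have h₁ : F ∪ insert e (F ∩ G) = insert e F := by grind
    have h₂ : F ∩ insert e (F ∩ G) = F ∩ G := by grind
    rw [h₁, h₂] at h
    have := hF e he
    omega
  intro e he
  by_cases heF : e ∈ F
  · rw [Finset.inter_comm]
    exact key hG fun heG => he (Finset.mem_inter.2 ⟨heF, heG⟩)
  · exact key hF heF

theorem basePolytope_subset_hypersimplex {α : Type*} [Fintype α] [DecidableEq α]
    {rank : Finset α → ℕ} (hrank_mono : ∀ ⦃S T : Finset α⦄, S ⊆ T → rank S ≤ rank T)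
    (hloopfree : ∀ e : α, rank {e} = 1) {r : ℕ} (hrank_univ : rank Finset.univ = r) :
    basePolytope rank r ⊆ hypersimplex α r := by
  rintro x ⟨hx, hsum⟩
  refine ⟨fun e => ⟨?_, by simpa [hloopfree] using hx {e}⟩, hsum⟩
  have h := hx (Finset.univ.erase e)
  have h₁ : (rank (Finset.univ.erase e) : ℝ) ≤ r := by
    exact_mod_cast hrank_univ ▸ hrank_mono (Finset.erase_subset e _)
  have h₂ := Finset.add_sum_erase Finset.univ x (Finset.mem_univ e)
  linarith

/-- Let `M` be a loop-free matroid of rank `r` on a finite ground set `E`.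
Then, pointwise, `1_{Δ(M)} = Σ_{F•} (-1)^{k-1} 1_{⊓^{F•,M}}`, the sum being over all
chains `∅ = F₀ ⊊ F₁ ⊊ ⋯ ⊊ F_k = E` in which every `F_i` is a flat of `M`.  A chain is
recorded by the finite set `C` of its intermediate members `F₁, …, F_{k-1}` (a totally
ordered family of proper nonempty flats), so that `k = |C| + 1`. -/
theorem indicator_basePolytope_eq_sum_halfOpen_flats {α : Type*} [Fintype α] [DecidableEq α]
    (rank : Finset α → ℕ)
    (hrank_empty : rank ∅ = 0)
    (hrank_mono : ∀ ⦃S T : Finset α⦄, S ⊆ T → rank S ≤ rank T)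
    (hrank_submod : ∀ S T : Finset α, rank (S ∪ T) + rank (S ∩ T) ≤ rank S + rank T)
    (hrank_step : ∀ (S : Finset α) (e : α), rank (insert e S) ≤ rank S + 1)
    (hloopfree : ∀ e : α, rank {e} = 1)
    (r : ℕ) (hrank_univ : rank Finset.univ = r)
    (x : α → ℝ) :
    Set.indicator (basePolytope rank r) (fun _ => (1 : ℤ)) x =
      ∑ C ∈ Finset.univ.filter (fun C : Finset (Finset α) =>
          (∀ A ∈ C, IsFlat rank A ∧ A ≠ ∅ ∧ A ≠ Finset.univ) ∧
          (∀ A ∈ C, ∀ B ∈ C, A ⊆ B ∨ B ⊆ A)),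
        (-1 : ℤ) ^ C.card *
          Set.indicator (halfOpenSchubert rank r C) (fun _ => (1 : ℤ)) x := by
  classical
  by_cases hx : x ∈ hypersimplex α r
  swap
  · rw [Set.indicator_of_notMem fun h =>
      hx (basePolytope_subset_hypersimplex hrank_mono hloopfree hrank_univ h)]
    refine (Finset.sum_eq_zero fun C _ => ?_).symm
    rw [Set.indicator_of_notMem fun h => hx h.1, mul_zero]
  set P : Finset (Finset α) := Finset.univ.filter fun A =>
    IsFlat rank A ∧ (rank A : ℝ) < ∑ e ∈ A, x e with hPdef
  have mem_P : ∀ A, A ∈ P ↔ IsFlat rank A ∧ (rank A : ℝ) < ∑ e ∈ A, x e := by simp [hPdef]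
  have sum_le : ∀ {S T : Finset α}, S ⊆ T → ∑ e ∈ S, x e ≤ ∑ e ∈ T, x e := fun h =>
    Finset.sum_le_sum_of_subset_of_nonneg h fun e _ _ => (hx.1 e).1
  have hsum : ∑ C ∈ Finset.univ.filter (fun C : Finset (Finset α) =>
          (∀ A ∈ C, IsFlat rank A ∧ A ≠ ∅ ∧ A ≠ Finset.univ) ∧
          (∀ A ∈ C, ∀ B ∈ C, A ⊆ B ∨ B ⊆ A)),
        (-1 : ℤ) ^ C.card * Set.indicator (halfOpenSchubert rank r C) (fun _ => (1 : ℤ)) x =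
      ∑ C ∈ P.powerset.filter (fun C => ∀ A ∈ C, ∀ B ∈ C, A ⊆ B ∨ B ⊆ A),
        (-1 : ℤ) ^ C.card := by
    symm
    refine Finset.sum_subset_zero_on_sdiff ?_ ?_ ?_
    · intro C hC
      simp only [Finset.mem_filter, Finset.mem_powerset, Finset.mem_univ, true_and] at hC ⊢
      refine ⟨fun A hA => ?_, hC.2⟩
      obtain ⟨hflat, hlt⟩ := (mem_P A).1 (hC.1 hA)
      refine ⟨hflat, ?_, ?_⟩
      · rintro rfl
        simp [hrank_empty] at hlt
      · rintro rfl
        rw [hrank_univ, hx.2] at hlt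
        exact lt_irrefl _ hlt
    · intro C hC
      simp only [Finset.mem_sdiff, Finset.mem_filter, Finset.mem_powerset, Finset.mem_univ,
        true_and] at hC
      rw [Set.indicator_of_notMem, mul_zero]
      exact fun h => hC.2 ⟨fun A hA => (mem_P A).2 ⟨(hC.1.1 A hA).1, h.2 A hA⟩, hC.1.2⟩
    · intro C hC
      simp only [Finset.mem_filter, Finset.mem_powerset] at hC
      rw [Set.indicator_of_mem, mul_one]
      exact ⟨hx, fun A hA => ((mem_P A).1 (hC.1 hA)).2⟩
  rw [hsum]
  rcases P.eq_empty_or_nonempty with hP | hP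
  · rw [Set.indicator_of_mem]
    · simp [hP, Finset.filter_singleton]
    · refine ⟨fun S => ?_, hx.2⟩
      by_contra! h
      obtain ⟨T, hST, hT, hflat⟩ := exists_isFlat_superset hrank_mono S
      have : T ∈ P := (mem_P T).2 ⟨hflat, by rw [hT]; exact h.trans_le (sum_le hST)⟩
      simp [hP] at this
  · obtain ⟨A, hA, hmax⟩ := Finset.exists_max_image P (fun A => ∑ e ∈ A, x e - rank A) hP
    have hA' := (mem_P A).1 hA
    rw [Set.indicator_of_notMem fun h => absurd (h.1 A) (not_le.2 hA'.2)]
    refine (sum_neg_one_pow_card_chains_eq_zero hA fun B hB => ?_).symm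
    have hB' := (mem_P B).1 hB
    refine (mem_P _).2 ⟨hB'.1.inter hrank_submod hA'.1, ?_⟩
    obtain ⟨T, hT, hrankT, hflat⟩ := exists_isFlat_superset hrank_mono (B ∪ A)
    have hTA : ∑ e ∈ T, x e - rank T ≤ ∑ e ∈ A, x e - rank A := by
      by_cases hTP : T ∈ P
      · exact hmax T hTP
      · have : ∑ e ∈ T, x e ≤ rank T := not_lt.1 fun h => hTP ((mem_P T).2 ⟨hflat, h⟩)
        linarith [hA'.2]
    have h₁ := sum_le hT
    have h₂ := Finset.sum_union_inter (s₁ := B) (s₂ := A) (f := x)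
    have h₃ : (rank (B ∪ A) : ℝ) + rank (B ∩ A) ≤ rank B + rank A := by
      exact_mod_cast hrank_submod B A
    rw [hrankT] at hTA
    linarith [hB'.2]
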